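/- arXiv:2509.11907 — 2 statements merged into one kernel-verified Lean document; each statement's English description precedes it below -/
import Mathlib

section
/- If the initial state is x₀ = 0, then for every index i ∈ {1,…,N}, every ρ ∈ [0,1] and σ_u > 0, with input u(t) := (1−ρ)·u_d(t) + ρ·σ_u·h(t) (u_d deterministic with stacked vector U_d, h(0),…,h(T−1) i.i.d. standard Gaussian vectors in ℝ^{n_u} independent of the noise sequence g), one has Σ_{t=0}^{T−1} E[‖ΔA_i x(t) + ΔB_i u(t)‖_M²] ≥ (1−ρ)²·U_dᵀ W_i U_d + ρ²σ_u²·tr(W_i) + tr(S_wᵀ Q_i S_w). -/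
open Matrix MeasureTheory ProbabilityTheory
open scoped Kronecker

noncomputable section

def stdGaussianVec (n : ℕ) : Measure (Fin n → ℝ) :=
  Measure.pi fun _ => gaussianReal 0 1

instance (n : ℕ) : IsProbabilityMeasure (stdGaussianVec n) := by
  unfold stdGaussianVec; infer_instance

def stdGaussianSeq (T n : ℕ) : Measure (Fin T → Fin n → ℝ) :=
  Measure.pi fun _ => stdGaussianVec n

instance (T n : ℕ) : IsProbabilityMeasure (stdGaussianSeq T n) := by
  unfold stdGaussianSeq; infer_instance

def wnormSq {n : ℕ} (M : Matrix (Fin n) (Fin n) ℝ) (v : Fin n → ℝ) : ℝ :=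
  v ⬝ᵥ M.mulVec v

def SuMat (T nx nu : ℕ) (Astar : Matrix (Fin nx) (Fin nx) ℝ)
    (Bstar : Matrix (Fin nx) (Fin nu) ℝ) :
    Matrix (Fin T × Fin nx) (Fin T × Fin nu) ℝ :=
  Matrix.of fun p q =>
    if (q.1 : ℕ) < (p.1 : ℕ) then (Astar ^ ((p.1 : ℕ) - 1 - (q.1 : ℕ)) * Bstar) p.2 q.2 else 0

def SwMat (T nx : ℕ) (Astar sqrtSigw : Matrix (Fin nx) (Fin nx) ℝ) :
    Matrix (Fin T × Fin nx) (Fin T × Fin nx) ℝ :=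
  Matrix.of fun p q =>
    if (q.1 : ℕ) < (p.1 : ℕ) then (Astar ^ ((p.1 : ℕ) - 1 - (q.1 : ℕ)) * sqrtSigw) p.2 q.2 else 0

def Qblk (T nx : ℕ) (M ΔA : Matrix (Fin nx) (Fin nx) ℝ) :
    Matrix (Fin T × Fin nx) (Fin T × Fin nx) ℝ :=
  (1 : Matrix (Fin T) (Fin T) ℝ) ⊗ₖ (ΔAᵀ * M * ΔA)

def Rblk (T nx nu : ℕ) (M : Matrix (Fin nx) (Fin nx) ℝ) (ΔB : Matrix (Fin nx) (Fin nu) ℝ) :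
    Matrix (Fin T × Fin nu) (Fin T × Fin nu) ℝ :=
  (1 : Matrix (Fin T) (Fin T) ℝ) ⊗ₖ (ΔBᵀ * M * ΔB)

def Nblk (T nx nu : ℕ) (M ΔA : Matrix (Fin nx) (Fin nx) ℝ) (ΔB : Matrix (Fin nx) (Fin nu) ℝ) :
    Matrix (Fin T × Fin nu) (Fin T × Fin nx) ℝ :=
  (1 : Matrix (Fin T) (Fin T) ℝ) ⊗ₖ (ΔBᵀ * M * ΔA)

def Wmat (T nx nu : ℕ) (Astar M ΔA : Matrix (Fin nx) (Fin nx) ℝ)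
    (Bstar ΔB : Matrix (Fin nx) (Fin nu) ℝ) :
    Matrix (Fin T × Fin nu) (Fin T × Fin nu) ℝ :=
  Rblk T nx nu M ΔB + (SuMat T nx nu Astar Bstar)ᵀ * Qblk T nx M ΔA * SuMat T nx nu Astar Bstar
    + Nblk T nx nu M ΔA ΔB * SuMat T nx nu Astar Bstar
    + (Nblk T nx nu M ΔA ΔB * SuMat T nx nu Astar Bstar)ᵀ

def lambdaMax {n : ℕ} (M : Matrix (Fin n) (Fin n) ℝ) : ℝ :=
  sSup {r : ℝ | ∃ v : Fin n → ℝ, v ≠ 0 ∧ M.mulVec v = r • v}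

end

/-- A finite family of square-integrable, centered, pairwise uncorrelated real random variables
of unit variance. -/
structure IsIsotropic {Ω J : Type*} [DecidableEq J] [MeasurableSpace Ω]
    (z : Ω → J → ℝ) (μ : Measure Ω) : Prop where
  memLp : ∀ j, MemLp (fun ω => z ω j) 2 μ
  integral_eq_zero : ∀ j, ∫ ω, z ω j ∂μ = 0
  integral_mul : ∀ j k, ∫ ω, z ω j * z ω k ∂μ = if j = k then 1 else 0

namespace IsIsotropic

variable {Ω Ω' J J' K : Type*} [DecidableEq J] [DecidableEq J'] [MeasurableSpace Ω]
  [MeasurableSpace Ω'] {μ : Measure Ω} {ν : Measure Ω'} {z : Ω → J → ℝ}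

lemma memLp_affine [Fintype J] [IsProbabilityMeasure μ] (hz : IsIsotropic z μ) (a : K → ℝ)
    (L : Matrix K J ℝ) (k : K) : MemLp (fun ω => (a + L *ᵥ z ω) k) 2 μ := by
  have h : MemLp (fun ω => ∑ j, L k j * z ω j) 2 μ :=
    memLp_finsetSum _ fun j _ => (hz.memLp j).const_mul (L k j)
  exact (memLp_const (a k)).add h

lemma integral_affine_mul_affine [Fintype J] [IsProbabilityMeasure μ] (hz : IsIsotropic z μ)
    (a : K → ℝ) (L : Matrix K J ℝ) (k l : K) :
    ∫ ω, (a + L *ᵥ z ω) k * (a + L *ᵥ z ω) l ∂μ = a k * a l + (L * Lᵀ) k l := by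
  have hlin (k : K) : MemLp (fun ω => (L *ᵥ z ω) k) 2 μ := by
    simpa using hz.memLp_affine 0 L k
  have hmean (k : K) : ∫ ω, (L *ᵥ z ω) k ∂μ = 0 := by
    simp only [mulVec, dotProduct]
    rw [integral_finsetSum _ fun j _ => ((hz.memLp j).integrable one_le_two).const_mul _]
    simp [integral_const_mul, hz.integral_eq_zero]
  have hcov : ∫ ω, (L *ᵥ z ω) k * (L *ᵥ z ω) l ∂μ = (L * Lᵀ) k l := by
    have hint (j j' : J) : Integrable (fun ω => L k j * L l j' * (z ω j * z ω j')) μ :=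
      ((hz.memLp j).integrable_mul (hz.memLp j')).const_mul _
    have hexpand (ω : Ω) : (L *ᵥ z ω) k * (L *ᵥ z ω) l =
        ∑ j, ∑ j', L k j * L l j' * (z ω j * z ω j') := by
      simp only [mulVec, dotProduct, Finset.sum_mul_sum, mul_mul_mul_comm]
    simp_rw [hexpand]
    rw [integral_finsetSum _ fun j _ => integrable_finsetSum _ fun j' _ => hint j j']
    simp_rw [integral_finsetSum _ fun j' _ => hint _ j', integral_const_mul, hz.integral_mul]
    simp [mul_apply]
  have hk := (hlin k).integrable one_le_two
  have hl := (hlin l).integrable one_le_two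
  have hkl : Integrable (fun ω => (L *ᵥ z ω) k * (L *ᵥ z ω) l) μ :=
    (hlin k).integrable_mul (hlin l)
  have hexpand (ω : Ω) : (a + L *ᵥ z ω) k * (a + L *ᵥ z ω) l =
      a k * a l + a k * (L *ᵥ z ω) l + a l * (L *ᵥ z ω) k + (L *ᵥ z ω) k * (L *ᵥ z ω) l := by
    simp only [Pi.add_apply]; ring
  simp_rw [hexpand]
  rw [integral_add (by fun_prop) hkl, integral_add (by fun_prop) (by fun_prop),
    integral_add (by fun_prop) (by fun_prop), integral_const_mul (a k) fun ω => (L *ᵥ z ω) l,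
    integral_const_mul (a l) fun ω => (L *ᵥ z ω) k, hmean, hmean, hcov]
  simp

lemma integrable_quadForm_affine [Fintype J] [Fintype K] [IsProbabilityMeasure μ]
    (hz : IsIsotropic z μ) (a : K → ℝ) (L : Matrix K J ℝ) (P : Matrix K K ℝ) :
    Integrable (fun ω => (a + L *ᵥ z ω) ⬝ᵥ P *ᵥ (a + L *ᵥ z ω)) μ := by
  have h (k : K) : MemLp (fun ω => (P *ᵥ (a + L *ᵥ z ω)) k) 2 μ :=
    memLp_finsetSum _ fun l _ => (hz.memLp_affine a L l).const_mul (P k l)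
  exact integrable_finsetSum _ fun k _ => (hz.memLp_affine a L k).integrable_mul (h k)

lemma integral_quadForm_affine [Fintype J] [Fintype K] [IsProbabilityMeasure μ]
    (hz : IsIsotropic z μ) (a : K → ℝ) (L : Matrix K J ℝ) (P : Matrix K K ℝ) :
    ∫ ω, (a + L *ᵥ z ω) ⬝ᵥ P *ᵥ (a + L *ᵥ z ω) ∂μ = a ⬝ᵥ P *ᵥ a + (Lᵀ * P * L).trace := by
  have hexpand (v : K → ℝ) : v ⬝ᵥ P *ᵥ v = ∑ k, ∑ l, P k l * (v k * v l) := by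
    simp only [dotProduct, mulVec, Finset.mul_sum]
    exact Finset.sum_congr rfl fun k _ => Finset.sum_congr rfl fun l _ => by ring
  have hint (k l : K) :
      Integrable (fun ω => P k l * ((a + L *ᵥ z ω) k * (a + L *ᵥ z ω) l)) μ :=
    ((hz.memLp_affine a L k).integrable_mul (hz.memLp_affine a L l)).const_mul _
  have htrace : (Lᵀ * P * L).trace = ∑ k, ∑ l, P k l * (L * Lᵀ) k l := by
    rw [Matrix.mul_assoc, trace_mul_comm, Matrix.mul_assoc, trace]
    refine Finset.sum_congr rfl fun k _ => ?_
    rw [diag_apply, mul_apply]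
    refine Finset.sum_congr rfl fun l _ => ?_
    simp only [mul_apply, transpose_apply]
    simp only [mul_comm]
  simp_rw [hexpand]
  rw [integral_finsetSum _ fun k _ => integrable_finsetSum _ fun l _ => hint k l]
  simp_rw [integral_finsetSum _ fun l _ => hint _ l, integral_const_mul,
    hz.integral_affine_mul_affine, mul_add, Finset.sum_add_distrib, htrace]

lemma prod [IsProbabilityMeasure μ] [IsProbabilityMeasure ν] (hz : IsIsotropic z μ)
    {y : Ω' → J' → ℝ} (hy : IsIsotropic y ν) :
    IsIsotropic (fun ω : Ω × Ω' => Sum.elim (z ω.1) (y ω.2)) (μ.prod ν) where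
  memLp := by
    rintro (j | j)
    · exact (hz.memLp j).comp_measurePreserving measurePreserving_fst
    · exact (hy.memLp j).comp_measurePreserving measurePreserving_snd
  integral_eq_zero := by
    rintro (j | j)
    · simpa [hz.integral_eq_zero] using integral_fun_fst (μ := μ) (ν := ν) fun ω => z ω j
    · simpa [hy.integral_eq_zero] using integral_fun_snd (μ := μ) (ν := ν) fun ω => y ω j
  integral_mul := by
    rintro (j | j) (k | k)
    · simpa [hz.integral_mul] using
        integral_fun_fst (μ := μ) (ν := ν) fun ω => z ω j * z ω k
    · simpa [hz.integral_eq_zero] using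
        integral_prod_mul (μ := μ) (ν := ν) (fun ω => z ω j) fun ω => y ω k
    · simpa [hz.integral_eq_zero, mul_comm] using
        integral_prod_mul (μ := μ) (ν := ν) (fun ω => z ω k) fun ω => y ω j
    · simpa [hy.integral_mul] using
        integral_fun_snd (μ := μ) (ν := ν) fun ω => y ω j * y ω k

lemma pi [Fintype K] [DecidableEq K] [IsProbabilityMeasure μ] (hz : IsIsotropic z μ) :
    IsIsotropic (fun (ω : K → Ω) (p : K × J) => z (ω p.1) p.2) (Measure.pi fun _ => μ) := by
  have hmean (k : K) (j : J) : ∫ ω : K → Ω, z (ω k) j ∂(Measure.pi fun _ => μ) = 0 := by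
    rw [integral_comp_eval (μ := fun _ : K => μ) (f := fun ω => z ω j)
      (hz.memLp j).aestronglyMeasurable, hz.integral_eq_zero]
  refine ⟨fun p => (hz.memLp p.2).comp_measurePreserving (measurePreserving_eval _ p.1),
    fun p => hmean _ _, ?_⟩
  rintro ⟨k, j⟩ ⟨k', j'⟩
  rcases eq_or_ne k k' with rfl | hk
  · have := integral_comp_eval (μ := fun _ : K => μ) (i := k) (f := fun ω => z ω j * z ω j')
      ((hz.memLp j).aestronglyMeasurable.mul (hz.memLp j').aestronglyMeasurable)
    simpa [hz.integral_mul] using this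
  · have hmeas (k : K) (j : J) :
        AEStronglyMeasurable (fun ω : K → Ω => z (ω k) j) (Measure.pi fun _ => μ) :=
      (hz.memLp j).aestronglyMeasurable.comp_measurePreserving (measurePreserving_eval _ k)
    have hindep : IndepFun (fun ω : K → Ω => z (ω k) j) (fun ω : K → Ω => z (ω k') j')
        (Measure.pi fun _ => μ) := by
      have := (iIndepFun_pi (μ := fun _ : K => μ) (X := fun i ω => z ω (if i = k then j else j'))
        fun i => (hz.memLp _).aestronglyMeasurable.aemeasurable).indepFun hk
      simpa [hk.symm] using this
    rw [hindep.integral_fun_mul_eq_mul_integral (hmeas _ _) (hmeas _ _), hmean]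
    simp [hk]

lemma comp_equiv (hz : IsIsotropic z μ) (e : J' ≃ J) :
    IsIsotropic (fun ω j => z ω (e j)) μ :=
  ⟨fun j => hz.memLp (e j), fun j => hz.integral_eq_zero (e j), fun j k => by
    simp [hz.integral_mul]⟩

end IsIsotropic

lemma isIsotropic_gaussianReal :
    IsIsotropic (fun (x : ℝ) (_ : Unit) => x) (gaussianReal 0 1) where
  memLp _ := memLp_id_gaussianReal 2
  integral_eq_zero _ := integral_id_gaussianReal
  integral_mul _ _ := by
    have h := variance_of_integral_eq_zero (μ := gaussianReal 0 1) (X := id) aemeasurable_id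
      integral_id_gaussianReal
    rw [variance_id_gaussianReal] at h
    simpa [pow_two] using h.symm

lemma isIsotropic_stdGaussianSeq (T n : ℕ) :
    IsIsotropic (fun (ω : Fin T → Fin n → ℝ) (p : Fin T × Fin n) => ω p.1 p.2)
      (stdGaussianSeq T n) :=
  (isIsotropic_gaussianReal.pi.comp_equiv (Equiv.prodPUnit (Fin n)).symm).pi

lemma state_eq_sum {n T : ℕ} (A : Matrix (Fin n) (Fin n) ℝ) (f : Fin T → Fin n → ℝ)
    (x : ℕ → Fin n → ℝ) (h0 : x 0 = 0) (hrec : ∀ t : Fin T, x (t + 1) = A *ᵥ x t + f t)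
    (t : ℕ) (ht : t ≤ T) :
    x t = ∑ s : Fin T, if (s : ℕ) < t then (A ^ (t - 1 - (s : ℕ))) *ᵥ f s else 0 := by
  induction t with
  | zero => simp [h0]
  | succ t ih =>
    have hlast : f ⟨t, ht⟩ = ∑ s : Fin T, if s = ⟨t, ht⟩ then f s else 0 := by simp
    rw [hrec ⟨t, ht⟩, ih (Nat.le_of_succ_le ht), hlast, mulVec_sum, ← Finset.sum_add_distrib]
    refine Finset.sum_congr rfl fun s _ => ?_
    rcases lt_trichotomy (s : ℕ) t with hs | hs | hs
    · have hne : s ≠ ⟨t, ht⟩ := fun h => hs.ne (congrArg Fin.val h)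
      rw [if_pos hs, if_neg hne, if_pos (by omega), mulVec_mulVec, ← pow_succ', add_zero]
      congr 2
      omega
    · obtain rfl : s = ⟨t, ht⟩ := Fin.ext hs
      simp
    · have hne : s ≠ ⟨t, ht⟩ := fun h => hs.ne' (congrArg Fin.val h)
      rw [if_neg (by omega), if_neg hne, if_neg (by omega), mulVec_zero, add_zero]

lemma SuMat_mulVec_apply {T nx nu : ℕ} (A : Matrix (Fin nx) (Fin nx) ℝ)
    (B : Matrix (Fin nx) (Fin nu) ℝ) (u : Fin T → Fin nu → ℝ) (t : Fin T) (k : Fin nx) :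
    (SuMat T nx nu A B *ᵥ fun p => u p.1 p.2) (t, k) =
      (∑ s : Fin T, if (s : ℕ) < t then (A ^ ((t : ℕ) - 1 - (s : ℕ))) *ᵥ (B *ᵥ u s) else 0) k := by
  simp only [mulVec, dotProduct, Fintype.sum_prod_type, Finset.sum_apply]
  refine Finset.sum_congr rfl fun s _ => ?_
  split_ifs with h
  · simp only [SuMat, of_apply, h, if_true]
    exact congrFun (mulVec_mulVec (u s) (A ^ ((t : ℕ) - 1 - (s : ℕ))) B).symm k
  · simp only [SuMat, of_apply, h, if_false, zero_mul, Finset.sum_const_zero, Pi.zero_apply]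

lemma SwMat_eq_SuMat (T nx : ℕ) (A S : Matrix (Fin nx) (Fin nx) ℝ) :
    SwMat T nx A S = SuMat T nx nx A S := rfl

lemma state_apply_eq_SuMat_add_SwMat {T nx nu : ℕ} (A S : Matrix (Fin nx) (Fin nx) ℝ)
    (B : Matrix (Fin nx) (Fin nu) ℝ) (u : Fin T → Fin nu → ℝ) (g : Fin T → Fin nx → ℝ)
    (x : ℕ → Fin nx → ℝ) (h0 : x 0 = 0)
    (hrec : ∀ t : Fin T, x (t + 1) = A *ᵥ x t + B *ᵥ u t + S *ᵥ g t) (t : Fin T) (k : Fin nx) :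
    x t k = (SuMat T nx nu A B *ᵥ (fun p => u p.1 p.2) +
      SwMat T nx A S *ᵥ fun p => g p.1 p.2) (t, k) := by
  rw [Pi.add_apply, SwMat_eq_SuMat, SuMat_mulVec_apply, SuMat_mulVec_apply, Finset.sum_apply,
    Finset.sum_apply, ← Finset.sum_add_distrib, state_eq_sum A (fun s => B *ᵥ u s + S *ᵥ g s) x h0
      (fun t => by rw [hrec, add_assoc]) t t.is_le', Finset.sum_apply]
  refine Finset.sum_congr rfl fun s _ => ?_
  split_ifs <;> simp [mulVec_add]

lemma one_kronecker_mulVec_apply {T m n : Type*} [Fintype T] [DecidableEq T] [Fintype n]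
    (C : Matrix m n ℝ) (v : T × n → ℝ) (t : T) (k : m) :
    (((1 : Matrix T T ℝ) ⊗ₖ C) *ᵥ v) (t, k) = (C *ᵥ fun l => v (t, l)) k := by
  simp [mulVec, dotProduct, Fintype.sum_prod_type, one_apply, ite_mul]

lemma trace_fromBlocks_eq_add {m n R : Type*} [Fintype m] [Fintype n] [AddCommMonoid R]
    (A : Matrix m m R) (B : Matrix m n R) (C : Matrix n m R) (D : Matrix n n R) :
    (fromBlocks A B C D).trace = A.trace + D.trace := by
  simp [trace]

lemma sum_wnormSq_eq {T n : ℕ} (M : Matrix (Fin n) (Fin n) ℝ) (v : Fin T × Fin n → ℝ) :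
    ∑ t, wnormSq M (fun k => v (t, k)) = v ⬝ᵥ ((1 : Matrix (Fin T) (Fin T) ℝ) ⊗ₖ M) *ᵥ v := by
  simp only [wnormSq, dotProduct, Fintype.sum_prod_type, one_kronecker_mulVec_apply]

section

variable (T nx nu : ℕ)

/-- The linear map from the stacked input to the stacked prediction errors. -/
def inputErrorMat (A ΔA : Matrix (Fin nx) (Fin nx) ℝ) (B ΔB : Matrix (Fin nx) (Fin nu) ℝ) :
    Matrix (Fin T × Fin nx) (Fin T × Fin nu) ℝ :=
  ((1 : Matrix (Fin T) (Fin T) ℝ) ⊗ₖ ΔA) * SuMat T nx nu A B +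
    (1 : Matrix (Fin T) (Fin T) ℝ) ⊗ₖ ΔB

/-- The linear map from the stacked standardized noise to the stacked prediction errors. -/
def noiseErrorMat (A S ΔA : Matrix (Fin nx) (Fin nx) ℝ) :
    Matrix (Fin T × Fin nx) (Fin T × Fin nx) ℝ :=
  ((1 : Matrix (Fin T) (Fin T) ℝ) ⊗ₖ ΔA) * SwMat T nx A S

lemma one_kronecker_transpose_mul_mul {m n p : Type*} [Fintype m]
    (C : Matrix m n ℝ) (D : Matrix m p ℝ) (M : Matrix m m ℝ) :
    (1 : Matrix (Fin T) (Fin T) ℝ) ⊗ₖ (Cᵀ * M * D) =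
      ((1 : Matrix (Fin T) (Fin T) ℝ) ⊗ₖ C)ᵀ * ((1 : Matrix (Fin T) (Fin T) ℝ) ⊗ₖ M) *
        ((1 : Matrix (Fin T) (Fin T) ℝ) ⊗ₖ D) := by
  rw [← kroneckerMap_transpose, transpose_one, ← mul_kronecker_mul, ← mul_kronecker_mul,
    Matrix.one_mul, Matrix.one_mul]

lemma Wmat_eq_inputErrorMat (A M ΔA : Matrix (Fin nx) (Fin nx) ℝ)
    (B ΔB : Matrix (Fin nx) (Fin nu) ℝ) (hM : Mᵀ = M) :
    Wmat T nx nu A M ΔA B ΔB = (inputErrorMat T nx nu A ΔA B ΔB)ᵀ *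
      ((1 : Matrix (Fin T) (Fin T) ℝ) ⊗ₖ M) * inputErrorMat T nx nu A ΔA B ΔB := by
  have hsymm : ((1 : Matrix (Fin T) (Fin T) ℝ) ⊗ₖ M)ᵀ = (1 : Matrix (Fin T) (Fin T) ℝ) ⊗ₖ M := by
    rw [← kroneckerMap_transpose, transpose_one, hM]
  simp only [Wmat, Rblk, Qblk, Nblk, one_kronecker_transpose_mul_mul]
  simp only [inputErrorMat, transpose_add, transpose_mul, transpose_transpose, hsymm, Matrix.add_mul, Matrix.mul_add,
    Matrix.mul_assoc]
  abel

lemma SwMat_Qblk_eq_noiseErrorMat (A S M ΔA : Matrix (Fin nx) (Fin nx) ℝ) :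
    (SwMat T nx A S)ᵀ * Qblk T nx M ΔA * SwMat T nx A S = (noiseErrorMat T nx A S ΔA)ᵀ *
      ((1 : Matrix (Fin T) (Fin T) ℝ) ⊗ₖ M) * noiseErrorMat T nx A S ΔA := by
  simp only [Qblk, one_kronecker_transpose_mul_mul]
  simp only [noiseErrorMat, transpose_mul, Matrix.mul_assoc]

end

/-- First bullet point of the Lemma of Appendix G: with zero initial state, the expected sum of
weighted prediction-error differences is lower-bounded by the input-energy and noise terms. -/
theorem expected_error_lower_bound_zero_init
    (nx nu N T : ℕ) (hnx : 1 ≤ nx) (hnu : 1 ≤ nu) (hN : 1 ≤ N) (hT : 1 ≤ T)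
    (Astar : Matrix (Fin nx) (Fin nx) ℝ) (Bstar : Matrix (Fin nx) (Fin nu) ℝ)
    (Sigw sqrtSigw : Matrix (Fin nx) (Fin nx) ℝ)
    (hSigw : Sigw.PosDef) (hsqrtW : sqrtSigw.PosSemidef) (hsqrtW2 : sqrtSigw * sqrtSigw = Sigw)
    (A : Fin N → Matrix (Fin nx) (Fin nx) ℝ) (B : Fin N → Matrix (Fin nx) (Fin nu) ℝ)
    (M : Matrix (Fin nx) (Fin nx) ℝ) (hM : M.PosDef)
    (i : Fin N) (ρ σu : ℝ) (hρ : ρ ∈ Set.Icc (0 : ℝ) 1) (hσu : 0 < σu)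
    (ud : Fin T → Fin nu → ℝ)
    (x : ℕ → ((Fin T → Fin nu → ℝ) × (Fin T → Fin nx → ℝ)) → (Fin nx → ℝ))
    (hx0 : ∀ ω, x 0 ω = 0)
    (hxrec : ∀ (t : Fin T) ω,
      x ((t : ℕ) + 1) ω =
        Astar.mulVec (x (t : ℕ) ω)
          + Bstar.mulVec ((1 - ρ) • ud t + (ρ * σu) • ω.1 t)
          + sqrtSigw.mulVec (ω.2 t)) :
    (∑ t : Fin T,
        ∫ ω, wnormSq M ((Astar - A i).mulVec (x (t : ℕ) ω)
            + (Bstar - B i).mulVec ((1 - ρ) • ud t + (ρ * σu) • ω.1 t))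
          ∂((stdGaussianSeq T nu).prod (stdGaussianSeq T nx)))
      ≥ (1 - ρ) ^ 2 *
          ((fun p : Fin T × Fin nu => ud p.1 p.2) ⬝ᵥ
            (Wmat T nx nu Astar M (Astar - A i) Bstar (Bstar - B i)).mulVec
              (fun p : Fin T × Fin nu => ud p.1 p.2))
        + ρ ^ 2 * σu ^ 2 *
            (Wmat T nx nu Astar M (Astar - A i) Bstar (Bstar - B i)).trace
        + ((SwMat T nx Astar sqrtSigw)ᵀ * Qblk T nx M (Astar - A i) *
            SwMat T nx Astar sqrtSigw).trace := by
  set F := inputErrorMat T nx nu Astar (Astar - A i) Bstar (Bstar - B i) with hF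
  set G := noiseErrorMat T nx Astar sqrtSigw (Astar - A i) with hG
  set P := (1 : Matrix (Fin T) (Fin T) ℝ) ⊗ₖ M
  set μ := (stdGaussianSeq T nu).prod (stdGaussianSeq T nx)
  set Ud : Fin T × Fin nu → ℝ := fun p => ud p.1 p.2
  set z : (Fin T → Fin nu → ℝ) × (Fin T → Fin nx → ℝ) →
      (Fin T × Fin nu) ⊕ (Fin T × Fin nx) → ℝ :=
    fun ω => Sum.elim (fun p => ω.1 p.1 p.2) (fun p => ω.2 p.1 p.2) with hzdef
  have hz : IsIsotropic z μ :=
    (isIsotropic_stdGaussianSeq T nu).prod (isIsotropic_stdGaussianSeq T nx)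
  set a : Fin T × Fin nx → ℝ := (1 - ρ) • F *ᵥ Ud with ha
  set L := fromCols ((ρ * σu) • F) G with hL
  have herr (t : Fin T) (ω) : (Astar - A i).mulVec (x (t : ℕ) ω)
      + (Bstar - B i).mulVec ((1 - ρ) • ud t + (ρ * σu) • ω.1 t) =
      fun k => (a + L *ᵥ z ω) (t, k) := by
    set u : Fin T → Fin nu → ℝ := fun t => (1 - ρ) • ud t + (ρ * σu) • ω.1 t
    have hvec : a + L *ᵥ z ω = F *ᵥ (fun p => u p.1 p.2) + G *ᵥ fun p => ω.2 p.1 p.2 := by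
      have hsplit : (fun p : Fin T × Fin nu => u p.1 p.2) =
          (1 - ρ) • Ud + (ρ * σu) • fun p => ω.1 p.1 p.2 := rfl
      rw [hsplit, ha, hL, hzdef, fromCols_mulVec_sumElim, mulVec_add, mulVec_smul, mulVec_smul,
        smul_mulVec, add_assoc]
    have hstate (k : Fin nx) := state_apply_eq_SuMat_add_SwMat Astar sqrtSigw Bstar u ω.2
      (fun t => x t ω) (hx0 ω) (fun t => hxrec t ω) t k
    funext k
    rw [hvec, hF, hG, inputErrorMat, noiseErrorMat, add_mulVec, ← mulVec_mulVec, ← mulVec_mulVec,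
      add_right_comm, ← mulVec_add, Pi.add_apply, Pi.add_apply, one_kronecker_mulVec_apply,
      one_kronecker_mulVec_apply, ← funext hstate]
  have hWF := Wmat_eq_inputErrorMat T nx nu Astar M (Astar - A i) Bstar (Bstar - B i)
    hM.isHermitian
  have hdet : a ⬝ᵥ P *ᵥ a =
      (1 - ρ) ^ 2 * (Ud ⬝ᵥ (Wmat T nx nu Astar M (Astar - A i) Bstar (Bstar - B i)) *ᵥ Ud) := by
    rw [hWF, ha, mulVec_smul, smul_dotProduct, dotProduct_smul, ← mulVec_mulVec, ← mulVec_mulVec,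
      dotProduct_mulVec Ud, vecMul_transpose, smul_smul, smul_eq_mul, pow_two]
  have htrace : (Lᵀ * P * L).trace =
      ρ ^ 2 * σu ^ 2 * (Wmat T nx nu Astar M (Astar - A i) Bstar (Bstar - B i)).trace
        + ((SwMat T nx Astar sqrtSigw)ᵀ * Qblk T nx M (Astar - A i) *
            SwMat T nx Astar sqrtSigw).trace := by
    rw [hWF, SwMat_Qblk_eq_noiseErrorMat, hL, transpose_fromCols, fromRows_mul,
      fromRows_mul_fromCols, trace_fromBlocks_eq_add, transpose_smul, Matrix.smul_mul, Matrix.smul_mul,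
      Matrix.mul_smul, smul_smul, trace_smul, smul_eq_mul]
    ring
  simp_rw [herr]
  rw [← integral_finsetSum]
  · simp_rw [sum_wnormSq_eq]
    rw [hz.integral_quadForm_affine a L P, hdet, htrace, add_assoc]
  · intro t _
    exact hz.integrable_quadForm_affine (fun k => a (t, k)) (L.submatrix (fun k => (t, k)) id) M
end

section
/- If ρ = 1, i.e., the input is u(t) := σ_u·h(t) with h(0),…,h(T−1) i.i.d. standard Gaussian vectors in ℝ^{n_u} independent of the noise sequence g and σ_u > 0, then for every initial state x₀ ∈ ℝ^{n_x} and every index i ∈ {1,…,N}: Σ_{t=0}^{T−1} E[‖ΔA_i x(t) + ΔB_i u(t)‖_M²] ≥ σ_u²·tr(W_i) + tr(S_wᵀ Q_i S_w). -/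
open Matrix MeasureTheory ProbabilityTheory
open scoped Kronecker

/-- A family of centred, square-integrable, pairwise uncorrelated random variables of unit
variance. -/
structure IsWhite {Ω ι : Type*} [MeasurableSpace Ω] [DecidableEq ι] (ξ : ι → Ω → ℝ)
    (μ : Measure Ω) : Prop where
  memLp : ∀ a, MemLp (ξ a) 2 μ
  integral_eq_zero : ∀ a, ∫ ω, ξ a ω ∂μ = 0
  integral_mul : ∀ a b, ∫ ω, ξ a ω * ξ b ω ∂μ = (1 : Matrix ι ι ℝ) a b

namespace IsWhite

variable {Ω ι m : Type*} [MeasurableSpace Ω] [DecidableEq ι] {ξ : ι → Ω → ℝ} {μ : Measure Ω}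

lemma of_hasLaw_gaussianReal (hlaw : ∀ a, HasLaw (ξ a) (gaussianReal 0 1) μ)
    (hindep : Pairwise fun a b => IndepFun (ξ a) (ξ b) μ) : IsWhite ξ μ := by
  have hzero (a : ι) : ∫ ω, ξ a ω ∂μ = 0 := by
    rw [(hlaw a).integral_eq, integral_id_gaussianReal]
  refine ⟨fun a => ?_, hzero, fun a b => ?_⟩
  · have h : MemLp id 2 (μ.map (ξ a)) := by
      rw [(hlaw a).map_eq]
      exact memLp_id_gaussianReal' 2 (by simp)
    exact h.comp_of_map (hlaw a).aemeasurable
  · rcases eq_or_ne a b with rfl | hab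
    · have h := (hlaw a).variance_eq
      rw [variance_id_gaussianReal,
        variance_of_integral_eq_zero (hlaw a).aemeasurable (hzero a)] at h
      simpa [pow_two] using h
    · rw [(hindep hab).integral_fun_mul_eq_mul_integral
        (hlaw a).aemeasurable.aestronglyMeasurable (hlaw b).aemeasurable.aestronglyMeasurable,
        hzero, Matrix.one_apply_ne hab, zero_mul]

variable [Fintype ι]

lemma memLp_affine [IsFiniteMeasure μ] (h : IsWhite ξ μ) (F : Matrix m ι ℝ) (c : m → ℝ) (p : m) :
    MemLp (fun ω => (c + F *ᵥ fun a => ξ a ω) p) 2 μ :=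
  (memLp_const (c p)).add (memLp_finsetSum _ fun a _ => (h.memLp a).const_mul (F p a))

lemma integral_affine_mul [IsProbabilityMeasure μ] (h : IsWhite ξ μ) (F : Matrix m ι ℝ)
    (c : m → ℝ) (p q : m) :
    ∫ ω, (c + F *ᵥ fun a => ξ a ω) p * (c + F *ᵥ fun a => ξ a ω) q ∂μ
      = c p * c q + (F * Fᵀ) p q := by
  have hint (a : ι) : Integrable (ξ a) μ := (h.memLp a).integrable (by norm_num)
  have hint₂ (a b : ι) : Integrable (fun ω => ξ a ω * ξ b ω) μ :=
    (h.memLp a).integrable_mul (h.memLp b)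
  have hlin : Integrable (fun ω => ∑ a, (c p * F q a + c q * F p a) * ξ a ω) μ :=
    integrable_finsetSum _ fun a _ => (hint a).const_mul _
  have hquad : Integrable (fun ω => ∑ a, ∑ b, F p a * F q b * (ξ a ω * ξ b ω)) μ :=
    integrable_finsetSum _ fun a _ => integrable_finsetSum _ fun b _ => (hint₂ a b).const_mul _
  have haffine : Integrable (fun ω => c p * c q + ∑ a, (c p * F q a + c q * F p a) * ξ a ω) μ :=
    (integrable_const _).add hlin
  have hexpand (ω : Ω) : (c + F *ᵥ fun a => ξ a ω) p * (c + F *ᵥ fun a => ξ a ω) q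
      = c p * c q + ∑ a, (c p * F q a + c q * F p a) * ξ a ω
        + ∑ a, ∑ b, F p a * F q b * (ξ a ω * ξ b ω) := by
    have hprod : ∑ a, ∑ b, F p a * F q b * (ξ a ω * ξ b ω)
        = (∑ a, F p a * ξ a ω) * ∑ b, F q b * ξ b ω := by
      rw [Finset.sum_mul_sum]
      exact Finset.sum_congr rfl fun a _ => Finset.sum_congr rfl fun b _ => by ring
    have hsum : ∑ a, (c p * F q a + c q * F p a) * ξ a ω
        = c p * ∑ a, F q a * ξ a ω + c q * ∑ a, F p a * ξ a ω := by
      rw [Finset.mul_sum, Finset.mul_sum, ← Finset.sum_add_distrib]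
      exact Finset.sum_congr rfl fun a _ => by ring
    rw [hprod, hsum]
    simp only [Pi.add_apply, Matrix.mulVec, dotProduct]
    ring
  simp_rw [hexpand]
  rw [integral_add haffine hquad, integral_add (integrable_const _) hlin,
    integral_finsetSum _ fun a _ => (hint a).const_mul _,
    integral_finsetSum _ fun a _ => integrable_finsetSum _ fun b _ => (hint₂ a b).const_mul _]
  simp_rw [integral_finsetSum Finset.univ fun b _ => (hint₂ _ b).const_mul _, integral_const_mul,
    h.integral_eq_zero, h.integral_mul]
  simp [Matrix.one_apply, Matrix.mul_apply]

lemma integral_dotProduct_mulVec [IsProbabilityMeasure μ] [Fintype m] (h : IsWhite ξ μ)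
    (F : Matrix m ι ℝ) (c : m → ℝ) (K : Matrix m m ℝ) :
    ∫ ω, (c + F *ᵥ fun a => ξ a ω) ⬝ᵥ K *ᵥ (c + F *ᵥ fun a => ξ a ω) ∂μ
      = c ⬝ᵥ K *ᵥ c + (Fᵀ * K * F).trace := by
  have hint (p q : m) : Integrable (fun ω =>
      K p q * ((c + F *ᵥ fun a => ξ a ω) p * (c + F *ᵥ fun a => ξ a ω) q)) μ :=
    ((h.memLp_affine F c p).integrable_mul (h.memLp_affine F c q)).const_mul _
  have hexpand (v : m → ℝ) : v ⬝ᵥ K *ᵥ v = ∑ p, ∑ q, K p q * (v p * v q) := by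
    simp only [Matrix.mulVec, dotProduct, Finset.mul_sum]
    exact Finset.sum_congr rfl fun p _ => Finset.sum_congr rfl fun q _ => by ring
  have htrace : (Fᵀ * K * F).trace = ∑ p, ∑ q, K p q * (F * Fᵀ) p q := by
    rw [Matrix.mul_assoc, Matrix.trace_mul_comm, Matrix.mul_assoc, Matrix.trace]
    refine Finset.sum_congr rfl fun p _ => ?_
    rw [Matrix.diag_apply, Matrix.mul_apply]
    refine Finset.sum_congr rfl fun q _ => ?_
    rw [← Matrix.transpose_apply (F * Fᵀ), Matrix.transpose_mul, Matrix.transpose_transpose]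
  simp_rw [hexpand]
  rw [integral_finsetSum _ fun p _ => integrable_finsetSum _ fun q _ => hint p q, htrace,
    ← Finset.sum_add_distrib]
  refine Finset.sum_congr rfl fun p _ => ?_
  rw [integral_finsetSum _ fun q _ => hint p q, ← Finset.sum_add_distrib]
  refine Finset.sum_congr rfl fun q _ => ?_
  rw [integral_const_mul, h.integral_affine_mul, mul_add]

end IsWhite

lemma iIndepFun_comp_measurePreserving {Ω Ω' ι 𝓧 : Type*} [MeasurableSpace Ω]
    [MeasurableSpace Ω'] [MeasurableSpace 𝓧] {μ : Measure Ω} {ν : Measure Ω'} {X : ι → Ω' → 𝓧}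
    (hX : iIndepFun X ν) (hXm : ∀ i, Measurable (X i)) {f : Ω → Ω'}
    (hf : MeasurePreserving f μ ν) : iIndepFun (fun i ω => X i (f ω)) μ := by
  rw [iIndepFun_iff_measure_inter_preimage_eq_mul] at hX ⊢
  intro S sets hsets
  have hpre (i : ι) (hi : i ∈ S) : MeasurableSet (X i ⁻¹' sets i) := hXm i (hsets i hi)
  have h := hX S hsets
  rw [← hf.measure_preimage (Finset.measurableSet_biInter S hpre).nullMeasurableSet,
    Set.preimage_iInter₂] at h
  refine h.trans (Finset.prod_congr rfl fun i hi => ?_)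
  exact (hf.measure_preimage (hpre i hi).nullMeasurableSet).symm

lemma hasLaw_stdGaussianSeq_eval {T n : ℕ} (p : Fin T × Fin n) :
    HasLaw (fun h : Fin T → Fin n → ℝ => h p.1 p.2) (gaussianReal 0 1) (stdGaussianSeq T n) :=
  ((measurePreserving_eval (fun _ : Fin n => gaussianReal 0 1) p.2).comp
    (measurePreserving_eval (fun _ : Fin T => stdGaussianVec n) p.1)).hasLaw

lemma iIndepFun_stdGaussianSeq_eval (T n : ℕ) :
    iIndepFun (fun (p : Fin T × Fin n) (h : Fin T → Fin n → ℝ) => h p.1 p.2)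
      (stdGaussianSeq T n) := by
  refine iIndepFun_uncurry' (X := fun t k (h : Fin T → Fin n → ℝ) => h t k)
    (fun t k => by fun_prop) ?_ fun t => ?_
  · exact iIndepFun_pi (μ := fun _ : Fin T => stdGaussianVec n) (X := fun _ v => v)
      fun _ => aemeasurable_id
  · have hvec : iIndepFun (fun (k : Fin n) (v : Fin n → ℝ) => v k) (stdGaussianVec n) :=
      iIndepFun_pi (μ := fun _ : Fin n => gaussianReal 0 1) (X := fun _ r => r)
        fun _ => aemeasurable_id
    exact iIndepFun_comp_measurePreserving hvec (fun k => measurable_pi_apply k)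
      (measurePreserving_eval (fun _ : Fin T => stdGaussianVec n) t)

/-- The scalar coordinates of a pair of vector sequences. -/
def noiseCoord {T n k : ℕ} (a : (Fin T × Fin n) ⊕ (Fin T × Fin k))
    (ω : (Fin T → Fin n → ℝ) × (Fin T → Fin k → ℝ)) : ℝ :=
  Sum.elim (fun p => ω.1 p.1 p.2) (fun p => ω.2 p.1 p.2) a

lemma isWhite_noiseCoord (T n k : ℕ) :
    IsWhite (noiseCoord (T := T) (n := n) (k := k))
      ((stdGaussianSeq T n).prod (stdGaussianSeq T k)) := by
  have hmp₁ : MeasurePreserving Prod.fst ((stdGaussianSeq T n).prod (stdGaussianSeq T k))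
      (stdGaussianSeq T n) := measurePreserving_fst
  have hmp₂ : MeasurePreserving Prod.snd ((stdGaussianSeq T n).prod (stdGaussianSeq T k))
      (stdGaussianSeq T k) := measurePreserving_snd
  refine IsWhite.of_hasLaw_gaussianReal ?_ ?_
  · rintro (p | p)
    · exact (hasLaw_stdGaussianSeq_eval p).comp hmp₁.hasLaw
    · exact (hasLaw_stdGaussianSeq_eval p).comp hmp₂.hasLaw
  · have hcross (p : Fin T × Fin n) (q : Fin T × Fin k) :
        IndepFun (noiseCoord (.inl p)) (noiseCoord (.inr q))
          ((stdGaussianSeq T n).prod (stdGaussianSeq T k)) :=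
      indepFun_prod (X := fun h : Fin T → Fin n → ℝ => h p.1 p.2)
        (Y := fun g : Fin T → Fin k → ℝ => g q.1 q.2) (by fun_prop) (by fun_prop)
    rintro (p | p) (q | q) hpq
    · exact (iIndepFun_comp_measurePreserving (iIndepFun_stdGaussianSeq_eval T n)
        (fun _ => by fun_prop) hmp₁).indepFun fun h => hpq (h ▸ rfl)
    · exact hcross p q
    · exact (hcross q p).symm
    · exact (iIndepFun_comp_measurePreserving (iIndepFun_stdGaussianSeq_eval T k)
        (fun _ => by fun_prop) hmp₂).indepFun fun h => hpq (h ▸ rfl)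

section LinearSystem

variable {T n k : ℕ}

lemma one_kronecker_mulVec (P : Matrix (Fin n) (Fin k) ℝ) (v : Fin T × Fin k → ℝ)
    (p : Fin T × Fin n) :
    (((1 : Matrix (Fin T) (Fin T) ℝ) ⊗ₖ P) *ᵥ v) p = (P *ᵥ fun j => v (p.1, j)) p.2 := by
  simp [Matrix.mulVec, dotProduct, Fintype.sum_prod_type, Matrix.one_apply]

lemma dotProduct_one_kronecker_mulVec (M : Matrix (Fin n) (Fin n) ℝ) (v : Fin T × Fin n → ℝ) :
    v ⬝ᵥ ((1 : Matrix (Fin T) (Fin T) ℝ) ⊗ₖ M) *ᵥ v = ∑ t, wnormSq M fun j => v (t, j) := by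
  simp only [dotProduct, one_kronecker_mulVec, Fintype.sum_prod_type, wnormSq]

lemma SuMat_mulVec (A : Matrix (Fin n) (Fin n) ℝ) (B : Matrix (Fin n) (Fin k) ℝ)
    (v : Fin T × Fin k → ℝ) (t : Fin T) :
    (fun j => (SuMat T n k A B *ᵥ v) (t, j))
      = ∑ s : Fin T, if (s : ℕ) < t then A ^ ((t : ℕ) - 1 - s) *ᵥ B *ᵥ (fun j => v (s, j))
          else 0 := by
  ext j
  simp only [Matrix.mulVec_mulVec, Finset.sum_apply]
  simp only [Matrix.mulVec, dotProduct, Fintype.sum_prod_type, SuMat, Matrix.of_apply]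
  refine Finset.sum_congr rfl fun s _ => ?_
  split_ifs <;> simp [Matrix.mulVec, dotProduct]

/-- Variation of constants for a discrete-time linear system. -/
lemma linear_recursion_eq (A : Matrix (Fin n) (Fin n) ℝ) (x : ℕ → Fin n → ℝ)
    (v : Fin T → Fin n → ℝ) (hx : ∀ t : Fin T, x (t + 1) = A *ᵥ x t + v t) {t : ℕ} (ht : t ≤ T) :
    x t = A ^ t *ᵥ x 0 + ∑ s : Fin T, if (s : ℕ) < t then A ^ (t - 1 - s) *ᵥ v s else 0 := by
  induction t with
  | zero => simp
  | succ t ih =>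
    have hsplit (s : Fin T) : (if (s : ℕ) < t + 1 then A ^ (t + 1 - 1 - s) *ᵥ v s else 0)
        = (A *ᵥ if (s : ℕ) < t then A ^ (t - 1 - s) *ᵥ v s else 0)
          + if s = ⟨t, ht⟩ then v s else 0 := by
      rcases lt_trichotomy (s : ℕ) t with h | h | h
      · have hpow : t + 1 - 1 - (s : ℕ) = t - 1 - s + 1 := by omega
        rw [if_pos (by omega), if_pos h, if_neg (by simp [Fin.ext_iff, h.ne]), hpow, pow_succ',
          Matrix.mulVec_mulVec, add_zero]
      · simp [Fin.ext_iff, h]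
      · rw [if_neg (by omega), if_neg (by omega), if_neg (by simp [Fin.ext_iff, h.ne'])]
        simp
    have hstep := hx ⟨t, ht⟩
    simp only at hstep
    rw [hstep, ih (by omega), Matrix.mulVec_add, Matrix.mulVec_mulVec, ← pow_succ',
      Matrix.mulVec_sum, Finset.sum_congr rfl fun s _ => hsplit s, Finset.sum_add_distrib]
    simp [add_assoc]

lemma one_kronecker_transpose_mul_mul_s2 {l m : ℕ} (P : Matrix (Fin n) (Fin l) ℝ)
    (Q : Matrix (Fin n) (Fin k) ℝ) (R : Matrix (Fin k) (Fin m) ℝ) :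
    (1 : Matrix (Fin T) (Fin T) ℝ) ⊗ₖ (Pᵀ * Q * R)
      = ((1 : Matrix (Fin T) (Fin T) ℝ) ⊗ₖ P)ᵀ * ((1 : Matrix (Fin T) (Fin T) ℝ) ⊗ₖ Q)
        * ((1 : Matrix (Fin T) (Fin T) ℝ) ⊗ₖ R) := by
  rw [← Matrix.kroneckerMap_transpose, Matrix.transpose_one, ← Matrix.mul_kronecker_mul,
    ← Matrix.mul_kronecker_mul, Matrix.one_mul, Matrix.one_mul]

lemma Wmat_eq_transpose_mul_mul {M : Matrix (Fin n) (Fin n) ℝ} (hM : Mᵀ = M)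
    (A ΔA : Matrix (Fin n) (Fin n) ℝ) (B ΔB : Matrix (Fin n) (Fin k) ℝ) :
    Wmat T n k A M ΔA B ΔB
      = ((1 : Matrix (Fin T) (Fin T) ℝ) ⊗ₖ ΔB + (1 : Matrix (Fin T) (Fin T) ℝ) ⊗ₖ ΔA
          * SuMat T n k A B)ᵀ * ((1 : Matrix (Fin T) (Fin T) ℝ) ⊗ₖ M)
        * ((1 : Matrix (Fin T) (Fin T) ℝ) ⊗ₖ ΔB + (1 : Matrix (Fin T) (Fin T) ℝ) ⊗ₖ ΔA
          * SuMat T n k A B) := by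
  have hsymm : ((1 : Matrix (Fin T) (Fin T) ℝ) ⊗ₖ M)ᵀ = (1 : Matrix (Fin T) (Fin T) ℝ) ⊗ₖ M := by
    rw [← Matrix.kroneckerMap_transpose, Matrix.transpose_one, hM]
  simp only [Wmat, Rblk, Qblk, Nblk, one_kronecker_transpose_mul_mul_s2]
  simp only [Matrix.transpose_add, Matrix.transpose_mul, hsymm,
    Matrix.transpose_transpose, Matrix.add_mul, Matrix.mul_add, Matrix.mul_assoc]
  abel

lemma wnormSq_nonneg {M : Matrix (Fin n) (Fin n) ℝ} (hM : M.PosSemidef) (v : Fin n → ℝ) :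
    0 ≤ wnormSq M v := by
  simpa [wnormSq] using hM.dotProduct_mulVec_nonneg v

lemma integrable_wnormSq {Ω : Type*} [MeasurableSpace Ω] {μ : Measure Ω}
    (M : Matrix (Fin n) (Fin n) ℝ) {e : Ω → Fin n → ℝ} (he : ∀ j, MemLp (fun ω => e ω j) 2 μ) :
    Integrable (fun ω => wnormSq M (e ω)) μ := by
  simp only [wnormSq, Matrix.mulVec, dotProduct, Finset.mul_sum]
  exact integrable_finsetSum _ fun p _ => integrable_finsetSum _ fun q _ =>
    (he p).integrable_mul ((he q).const_mul (M p q))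

lemma trace_fromCols_transpose_mul_mul {m a b : Type*} [Fintype m] [Fintype a] [Fintype b]
    (E : Matrix m a ℝ) (G : Matrix m b ℝ) (K : Matrix m m ℝ) :
    ((Matrix.fromCols E G)ᵀ * K * Matrix.fromCols E G).trace
      = (Eᵀ * K * E).trace + (Gᵀ * K * G).trace := by
  rw [Matrix.transpose_fromCols, Matrix.fromRows_mul, Matrix.fromRows_mul_fromCols]
  simp [Matrix.trace]

end LinearSystem

/-- Second bullet point of the Lemma of Appendix G: with purely random input `u(t) = σ_u·h(t)`
(`ρ = 1`), for any initial state the expected sum of weighted prediction-error differences is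
lower-bounded by the trace terms. -/
theorem expected_error_lower_bound_random_input
    (nx nu N T : ℕ) (hnx : 1 ≤ nx) (hnu : 1 ≤ nu) (hN : 1 ≤ N) (hT : 1 ≤ T)
    (Astar : Matrix (Fin nx) (Fin nx) ℝ) (Bstar : Matrix (Fin nx) (Fin nu) ℝ)
    (Sigw sqrtSigw : Matrix (Fin nx) (Fin nx) ℝ)
    (hSigw : Sigw.PosDef) (hsqrtW : sqrtSigw.PosSemidef) (hsqrtW2 : sqrtSigw * sqrtSigw = Sigw)
    (A : Fin N → Matrix (Fin nx) (Fin nx) ℝ) (B : Fin N → Matrix (Fin nx) (Fin nu) ℝ)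
    (M : Matrix (Fin nx) (Fin nx) ℝ) (hM : M.PosDef)
    (i : Fin N) (x₀ : Fin nx → ℝ) (σu : ℝ) (hσu : 0 < σu)
    (x : ℕ → ((Fin T → Fin nu → ℝ) × (Fin T → Fin nx → ℝ)) → (Fin nx → ℝ))
    (hx0 : ∀ ω, x 0 ω = x₀)
    (hxrec : ∀ (t : Fin T) ω,
      x ((t : ℕ) + 1) ω =
        Astar.mulVec (x (t : ℕ) ω)
          + Bstar.mulVec (σu • ω.1 t)
          + sqrtSigw.mulVec (ω.2 t)) :
    (∑ t : Fin T,
        ∫ ω, wnormSq M ((Astar - A i).mulVec (x (t : ℕ) ω)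
            + (Bstar - B i).mulVec (σu • ω.1 t))
          ∂((stdGaussianSeq T nu).prod (stdGaussianSeq T nx)))
      ≥ σu ^ 2 * (Wmat T nx nu Astar M (Astar - A i) Bstar (Bstar - B i)).trace
        + ((SwMat T nx Astar sqrtSigw)ᵀ * Qblk T nx M (Astar - A i) *
            SwMat T nx Astar sqrtSigw).trace := by
  set ΔA := Astar - A i
  set ΔB := Bstar - B i
  set E := (1 : Matrix (Fin T) (Fin T) ℝ) ⊗ₖ ΔB
    + (1 : Matrix (Fin T) (Fin T) ℝ) ⊗ₖ ΔA * SuMat T nx nu Astar Bstar with hE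
  set G := (1 : Matrix (Fin T) (Fin T) ℝ) ⊗ₖ ΔA * SwMat T nx Astar sqrtSigw with hG
  set F := Matrix.fromCols (σu • E) G with hF
  let c : Fin T × Fin nx → ℝ := fun p => (ΔA *ᵥ Astar ^ (p.1 : ℕ) *ᵥ x₀) p.2
  have herr (t : Fin T) (ω) : ΔA *ᵥ x t ω + ΔB *ᵥ (σu • ω.1 t)
      = fun j => (c + F *ᵥ fun a => noiseCoord a ω) (t, j) := by
    have hstate : x t ω = Astar ^ (t : ℕ) *ᵥ x₀
        + σu • (fun j => (SuMat T nx nu Astar Bstar *ᵥ fun p => ω.1 p.1 p.2) (t, j))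
        + fun j => (SwMat T nx Astar sqrtSigw *ᵥ fun p => ω.2 p.1 p.2) (t, j) := by
      have hSw : SwMat T nx Astar sqrtSigw = SuMat T nx nx Astar sqrtSigw := rfl
      rw [linear_recursion_eq Astar (fun t => x t ω)
        (fun t => Bstar *ᵥ (σu • ω.1 t) + sqrtSigw *ᵥ ω.2 t)
        (fun t => by rw [hxrec t ω, add_assoc]) t.2.le, hx0, hSw, SuMat_mulVec, SuMat_mulVec,
        add_assoc, Finset.smul_sum, ← Finset.sum_add_distrib]
      congr 1
      refine Finset.sum_congr rfl fun s _ => ?_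
      split_ifs
      · simp only [Matrix.mulVec_add, Matrix.mulVec_smul]
      · simp
    have hFv : (F *ᵥ fun a => noiseCoord a ω)
        = σu • (E *ᵥ fun p => ω.1 p.1 p.2) + G *ᵥ fun p => ω.2 p.1 p.2 := by
      rw [hF, Matrix.fromCols_mulVec, Matrix.smul_mulVec]
      rfl
    rw [hFv, hstate, hE, hG, Matrix.add_mulVec, ← Matrix.mulVec_mulVec, ← Matrix.mulVec_mulVec]
    ext j
    simp only [Pi.add_apply, Pi.smul_apply, one_kronecker_mulVec, Matrix.mulVec_add,
      Matrix.mulVec_smul, smul_eq_mul, c]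
    ring
  have hwhite := isWhite_noiseCoord T nu nx
  simp_rw [herr]
  rw [← integral_finsetSum _ fun t _ =>
    integrable_wnormSq M fun j => hwhite.memLp_affine F c (t, j)]
  simp_rw [← dotProduct_one_kronecker_mulVec M]
  rw [hwhite.integral_dotProduct_mulVec, trace_fromCols_transpose_mul_mul,
    dotProduct_one_kronecker_mulVec, Wmat_eq_transpose_mul_mul (by simpa using hM.isHermitian.eq),
    Qblk, one_kronecker_transpose_mul_mul_s2]
  have hconst : 0 ≤ ∑ t, wnormSq M fun j => c (t, j) :=
    Finset.sum_nonneg fun t _ => wnormSq_nonneg hM.posSemidef _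
  have hEtrace : ((σu • E)ᵀ * ((1 : Matrix (Fin T) (Fin T) ℝ) ⊗ₖ M) * (σu • E)).trace
      = σu ^ 2 * (Eᵀ * ((1 : Matrix (Fin T) (Fin T) ℝ) ⊗ₖ M) * E).trace := by
    simp only [Matrix.transpose_smul, Matrix.smul_mul, Matrix.mul_smul, Matrix.trace_smul,
      smul_eq_mul]
    ring
  have hGtrace : (Gᵀ * ((1 : Matrix (Fin T) (Fin T) ℝ) ⊗ₖ M) * G).trace
      = ((SwMat T nx Astar sqrtSigw)ᵀ * (((1 : Matrix (Fin T) (Fin T) ℝ) ⊗ₖ ΔA)ᵀ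
        * ((1 : Matrix (Fin T) (Fin T) ℝ) ⊗ₖ M) * ((1 : Matrix (Fin T) (Fin T) ℝ) ⊗ₖ ΔA))
        * SwMat T nx Astar sqrtSigw).trace := by
    simp only [hG, Matrix.transpose_mul, Matrix.mul_assoc]
  rw [hEtrace, hGtrace]
  linarith
end
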